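/- Let H be a real Hilbert space and D ⊆ H a symmetric set of unit vectors whose closed linear span is dense in H. Let f ∈ A₁(D), i.e., f lies in the closed convex hull of D. Let (G_m)_{m≥0} be the Relaxed Greedy Algorithm iterates: G₀ = 0; G₁ = ⟨f, g₁⟩ g₁ where g₁ ∈ D satisfies ⟨f, g₁⟩ = sup_{g ∈ D} ⟨f, g⟩; and for m ≥ 2, G_m = (1 − 1/m) G_{m−1} + (1/m) g_m, where g_m ∈ D satisfies ⟨f − G_{m−1}, g_m⟩ = sup_{g ∈ D} ⟨f − G_{m−1}, g⟩. Then for every m ≥ 1, ‖f − G_m‖ ≤ 2/√m. -/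

import Mathlib

open RealInnerProductSpace

/-- A linear functional is bounded on the closed convex hull of a set of unit vectors by its
supremum over that set. -/
theorem inner_le_sSup_of_mem_closure_convexHull {H : Type*} [NormedAddCommGroup H]
    [InnerProductSpace ℝ H] {D : Set H} (hD : ∀ g ∈ D, ‖g‖ = 1) {f : H}
    (hf : f ∈ closure (convexHull ℝ D)) (r : H) :
    ⟪r, f⟫ ≤ sSup ((fun x => ⟪r, x⟫) '' D) := by
  have hbdd : BddAbove ((fun x => ⟪r, x⟫) '' D) := by
    refine ⟨‖r‖, ?_⟩
    rintro _ ⟨x, hx, rfl⟩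
    simpa [hD x hx] using real_inner_le_norm r x
  have hclosed : IsClosed {x : H | ⟪r, x⟫ ≤ sSup ((fun x => ⟪r, x⟫) '' D)} :=
    isClosed_le (by fun_prop) continuous_const
  have hconvex : Convex ℝ {x : H | ⟪r, x⟫ ≤ sSup ((fun x => ⟪r, x⟫) '' D)} :=
    convex_halfSpace_le (innerₛₗ ℝ r).isLinear _
  exact closure_minimal
    (convexHull_min (fun x hx => le_csSup hbdd ⟨x, hx, rfl⟩) hconvex) hclosed hf

/-- The closed convex hull of a set of unit vectors lies in the closed unit ball. -/
theorem norm_le_one_of_mem_closure_convexHull {H : Type*} [NormedAddCommGroup H]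
    [InnerProductSpace ℝ H] {D : Set H} (hD : ∀ g ∈ D, ‖g‖ = 1) {f : H}
    (hf : f ∈ closure (convexHull ℝ D)) : ‖f‖ ≤ 1 := by
  have h := closure_minimal (convexHull_min (fun x hx => by simp [hD x hx])
    (convex_closedBall (0 : H) 1)) Metric.isClosed_closedBall hf
  simpa using h

/-- Subtracting the projection onto a unit vector does not increase the norm. -/
theorem norm_sub_inner_smul_le {H : Type*} [NormedAddCommGroup H] [InnerProductSpace ℝ H]
    (f : H) {g : H} (hg : ‖g‖ = 1) : ‖f - ⟪f, g⟫ • g‖ ≤ ‖f‖ := by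
  have h : ‖f - ⟪f, g⟫ • g‖ ^ 2 = ‖f‖ ^ 2 - ⟪f, g⟫ ^ 2 := by
    rw [norm_sub_sq_real, real_inner_smul_right, norm_smul, hg, mul_one, Real.norm_eq_abs, sq_abs]
    ring
  exact (sq_le_sq₀ (norm_nonneg _) (norm_nonneg _)).mp (by nlinarith [sq_nonneg ⟪f, g⟫])

/-- One relaxation step: moving towards `g` with weight `1 / t` increases the squared
residual, rescaled by the squared step count, by at most `‖f - g‖ ^ 2`, provided `f - g` has
nonpositive inner product with the current residual. -/
theorem sq_norm_relaxed_step_le {H : Type*} [NormedAddCommGroup H] [InnerProductSpace ℝ H]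
    (f x g : H) {t : ℝ} (ht : 1 ≤ t) (h : ⟪f - x, f - g⟫ ≤ 0) :
    t ^ 2 * ‖f - ((1 - 1 / t) • x + (1 / t) • g)‖ ^ 2 ≤
      (t - 1) ^ 2 * ‖f - x‖ ^ 2 + ‖f - g‖ ^ 2 := by
  have ht0 : t ≠ 0 := by positivity
  have hsmul : t • (f - ((1 - 1 / t) • x + (1 / t) • g)) = (t - 1) • (f - x) + (f - g) := by
    match_scalars <;> field_simp <;> ring
  calc
    t ^ 2 * ‖f - ((1 - 1 / t) • x + (1 / t) • g)‖ ^ 2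
        = ‖t • (f - ((1 - 1 / t) • x + (1 / t) • g))‖ ^ 2 := by
      rw [norm_smul, mul_pow, Real.norm_eq_abs, sq_abs]
    _ = (t - 1) ^ 2 * ‖f - x‖ ^ 2 + 2 * ((t - 1) * ⟪f - x, f - g⟫) + ‖f - g‖ ^ 2 := by
      rw [hsmul, norm_add_sq_real, real_inner_smul_left, norm_smul, mul_pow, Real.norm_eq_abs,
        sq_abs]
    _ ≤ (t - 1) ^ 2 * ‖f - x‖ ^ 2 + ‖f - g‖ ^ 2 := by
      nlinarith [mul_nonneg (sub_nonneg.mpr ht) (neg_nonneg.mpr h)]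

/-- The DeVore–Temlyakov theorem for the Relaxed Greedy Algorithm: with `D` a
symmetric dictionary (unit vectors with dense closed linear span) in a real
Hilbert space and `f ∈ A₁(D)` (the closed convex hull of `D`), the RGA
iterates `G_m` (with `G₀ = 0`, `G₁ = ⟨f, g₁⟩g₁` for a greedily chosen `g₁`,
and `G_m = (1 - 1/m)G_{m-1} + (1/m)g_m` for `m ≥ 2` with greedily chosen
`g_m`) satisfy `‖f - G_m‖ ≤ 2/√m` for every `m ≥ 1`. -/
theorem stmt_14 {H : Type*} [NormedAddCommGroup H] [InnerProductSpace ℝ H]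
    [CompleteSpace H]
    (D : Set H) (hDunit : ∀ g ∈ D, ‖g‖ = 1) (hDsym : ∀ g ∈ D, -g ∈ D)
    (hDdense : Dense (↑(Submodule.span ℝ D) : Set H))
    (f : H) (hf : f ∈ closure (convexHull ℝ D))
    (G g : ℕ → H)
    (hG0 : G 0 = 0)
    (hg1 : g 1 ∈ D ∧ ⟪f, g 1⟫ = sSup ((fun x => ⟪f, x⟫) '' D))
    (hG1 : G 1 = ⟪f, g 1⟫ • g 1)
    (hgm : ∀ m : ℕ, 2 ≤ m → g m ∈ D ∧
      ⟪f - G (m - 1), g m⟫ = sSup ((fun x => ⟪f - G (m - 1), x⟫) '' D))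
    (hGm : ∀ m : ℕ, 2 ≤ m →
      G m = (1 - 1 / (m : ℝ)) • G (m - 1) + (1 / (m : ℝ)) • g m) :
    ∀ m : ℕ, 1 ≤ m → ‖f - G m‖ ≤ 2 / Real.sqrt m := by
  have hf1 : ‖f‖ ≤ 1 := norm_le_one_of_mem_closure_convexHull hDunit hf
  have key : ∀ m : ℕ, 1 ≤ m → (m : ℝ) ^ 2 * ‖f - G m‖ ^ 2 ≤ 4 * m := by
    intro m hm
    induction m, hm using Nat.le_induction with
    | base =>
      have h := (norm_sub_inner_smul_le f (hDunit _ hg1.1)).trans hf1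
      rw [← hG1] at h
      norm_num
      nlinarith [norm_nonneg (f - G 1)]
    | succ n hn ih =>
      obtain ⟨hgD, hgsup⟩ := hgm (n + 1) (by omega)
      have hstep := hGm (n + 1) (by omega)
      rw [Nat.add_sub_cancel] at hgsup hstep
      have hinner : ⟪f - G n, f - g (n + 1)⟫ ≤ 0 := by
        rw [inner_sub_right, hgsup, sub_nonpos]
        exact inner_le_sSup_of_mem_closure_convexHull hDunit hf _
      have hnorm : ‖f - g (n + 1)‖ ≤ 2 := by
        linarith [norm_sub_le f (g (n + 1)), hDunit _ hgD]
      have h := sq_norm_relaxed_step_le f (G n) (g (n + 1)) (t := ((n + 1 : ℕ) : ℝ))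
        (by exact_mod_cast Nat.le_add_left 1 n) hinner
      rw [← hstep] at h
      push_cast at h ⊢
      rw [add_sub_cancel_right] at h
      nlinarith [norm_nonneg (f - g (n + 1))]
  intro m hm
  have hm0 : (0 : ℝ) < m := by exact_mod_cast hm
  rw [le_div_iff₀ (Real.sqrt_pos.mpr hm0)]
  refine (sq_le_sq₀ (by positivity) (by norm_num)).mp ?_
  rw [mul_pow, Real.sq_sqrt hm0.le]
  refine le_of_mul_le_mul_left ?_ hm0
  linarith [key m hm]
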